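/- arXiv:math/0111061 — 3 statements merged into one kernel-verified Lean document; each statement's English description precedes it below -/
import Mathlib

section
/- Let 𝒦 be a cartesian closed category, D an object of 𝒦, 𝒦[x] the polynomial cartesian closed category obtained by adjoining an indeterminate x : 𝖳 ⊢ D, and H : 𝒦 → 𝒦[x] the heritage functor. Then for every cartesian closed category ℒ, every strict cartesian closed functor M : 𝒦 → ℒ, and every arrow f : 𝖳 ⊢ MD of ℒ, there is a unique strict cartesian closed functor N : 𝒦[x] → ℒ such that N[x] = f and M = N∘H. -/
/-! Equational presentation of cartesian closed categories (Lambek/Došen style),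
the polynomial extension `K[x]` by an indeterminate `x : T ⊢ D`, and the
functional-completeness apparatus. -/

universe u v

/-- A cartesian closed category presented equationally ("CC category"):
a deductive system with terminal object `T`, products, exponentials,
the arrows `k`, `p¹`, `p²`, `ε`, the operations of pairing and currying,
satisfying the categorial and cartesian closed equalities. -/
structure CC : Type (max (u + 1) (v + 1)) where
  Obj : Type u
  Hom : Obj → Obj → Type v
  id : ∀ A, Hom A A
  /-- `comp g f` is `g ∘ f`. -/
  comp : ∀ {A B C}, Hom B C → Hom A B → Hom A C
  T : Obj
  prod : Obj → Obj → Obj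
  exp : Obj → Obj → Obj
  k : ∀ A, Hom A T
  p1 : ∀ A B, Hom (prod A B) A
  p2 : ∀ A B, Hom (prod A B) B
  eval : ∀ A B, Hom (prod A (exp A B)) B
  pair : ∀ {C A B}, Hom C A → Hom C B → Hom C (prod A B)
  curry : ∀ {A B C}, Hom (prod A C) B → Hom C (exp A B)
  comp_id : ∀ {A B} (f : Hom A B), comp f (id A) = f
  id_comp : ∀ {A B} (f : Hom A B), comp (id B) f = f
  assoc : ∀ {A B C E} (f : Hom A B) (g : Hom B C) (h : Hom C E),
    comp h (comp g f) = comp (comp h g) f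
  T_eta : ∀ {A} (f : Hom A T), f = k A
  prod_beta1 : ∀ {C A B} (f1 : Hom C A) (f2 : Hom C B),
    comp (p1 A B) (pair f1 f2) = f1
  prod_beta2 : ∀ {C A B} (f1 : Hom C A) (f2 : Hom C B),
    comp (p2 A B) (pair f1 f2) = f2
  prod_eta : ∀ {C A B} (h : Hom C (prod A B)),
    pair (comp (p1 A B) h) (comp (p2 A B) h) = h
  /-- (→β):  φ_{A,B} (γ_{A,C} f) = f, with φ g = ε ∘ (1 × g). -/
  exp_beta : ∀ {A B C} (f : Hom (prod A C) B),
    comp (eval A B) (pair (comp (id A) (p1 A C)) (comp (curry f) (p2 A C))) = f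
  /-- (→η):  γ_{A,C} (φ_{A,B} g) = g. -/
  exp_eta : ∀ {A B C} (g : Hom C (exp A B)),
    curry (comp (eval A B) (pair (comp (id A) (p1 A C)) (comp g (p2 A C)))) = g

namespace CC

variable (K : CC)

/-- `f × g = ⟨f ∘ p¹, g ∘ p²⟩`. -/
def prodMap {A B C E : K.Obj} (f : K.Hom A B) (g : K.Hom C E) :
    K.Hom (K.prod A C) (K.prod B E) :=
  K.pair (K.comp f (K.p1 A C)) (K.comp g (K.p2 A C))

/-- `φ_{A,B} g = ε_{A,B} ∘ (1_A × g)` for `g : C ⊢ A → B`. -/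
def phi {A B C : K.Obj} (g : K.Hom C (K.exp A B)) : K.Hom (K.prod A C) B :=
  K.comp (K.eval A B) (K.prodMap (K.id A) g)

/-- `f → g = γ (g ∘ ε ∘ (f × 1))` for `f : A ⊢ B`, `g : C ⊢ E`. -/
def expMap {A B C E : K.Obj} (f : K.Hom A B) (g : K.Hom C E) :
    K.Hom (K.exp B C) (K.exp A E) :=
  K.curry (K.comp g (K.comp (K.eval B C) (K.prodMap f (K.id (K.exp B C)))))

/-- `b⃖_{A,B,C} = ⟨p¹ ∘ p¹, p² × 1⟩ : (A×B)×C ⊢ A×(B×C)`. -/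
def bl (A B C : K.Obj) : K.Hom (K.prod (K.prod A B) C) (K.prod A (K.prod B C)) :=
  K.pair (K.comp (K.p1 A B) (K.p1 (K.prod A B) C)) (K.prodMap (K.p2 A B) (K.id C))

/-- `b⃗_{A,B,C} = ⟨1 × p¹, p² ∘ p²⟩ : A×(B×C) ⊢ (A×B)×C`. -/
def br (A B C : K.Obj) : K.Hom (K.prod A (K.prod B C)) (K.prod (K.prod A B) C) :=
  K.pair (K.prodMap (K.id A) (K.p1 B C)) (K.comp (K.p2 B C) (K.p2 A (K.prod B C)))

/-- `c_{A,B} = ⟨p², p¹⟩ : A×B ⊢ B×A`. -/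
def cswap (A B : K.Obj) : K.Hom (K.prod A B) (K.prod B A) :=
  K.pair (K.p2 A B) (K.p1 A B)

end CC

/-- Arrow terms of the CC system `𝒮` obtained from `K` by adjoining an
indeterminate arrow `x : T ⊢ D`: generated from `x` and the arrows of `K`
by formal composition, formal pairing and formal currying. -/
inductive Tm (K : CC.{u, v}) (D : K.Obj) : K.Obj → K.Obj → Type (max u v)
  | x : Tm K D K.T D
  | arr : ∀ {A B : K.Obj}, K.Hom A B → Tm K D A B
  | comp : ∀ {A B C : K.Obj}, Tm K D B C → Tm K D A B → Tm K D A C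
  | pair : ∀ {C A B : K.Obj}, Tm K D C A → Tm K D C B → Tm K D C (K.prod A B)
  | curry : ∀ {A B C : K.Obj}, Tm K D (K.prod A C) B → Tm K D C (K.exp A B)

namespace Tm

/-- Formal `φ_{A,B}` on arrow terms: `φ g = ε ∘ (1 × g)`. -/
def phiS {K : CC.{u, v}} {D : K.Obj} {A B C : K.Obj} (g : Tm K D C (K.exp A B)) :
    Tm K D (K.prod A C) B :=
  Tm.comp (.arr (K.eval A B))
    (Tm.pair (Tm.comp (.arr (K.id A)) (.arr (K.p1 A C)))
      (Tm.comp g (.arr (K.p2 A C))))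

end Tm

/-- The smallest CC equivalence relation `≡` on arrow terms of `𝒮`: an
equivalence relation which is a congruence for the formal operations,
contains all instances of the categorial and cartesian closed equalities,
and identifies the formal operations applied to arrows of `K` with the
corresponding operations of `K`. -/
inductive Eqv (K : CC.{u, v}) (D : K.Obj) : ∀ {A B : K.Obj}, Tm K D A B → Tm K D A B → Prop
  | refl {A B : K.Obj} (f : Tm K D A B) : Eqv K D f f
  | symm {A B : K.Obj} {f g : Tm K D A B} : Eqv K D f g → Eqv K D g f
  | trans {A B : K.Obj} {f g h : Tm K D A B} :
      Eqv K D f g → Eqv K D g h → Eqv K D f h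
  | comp_congr {A B C : K.Obj} {g g' : Tm K D B C} {f f' : Tm K D A B} :
      Eqv K D g g' → Eqv K D f f' → Eqv K D (.comp g f) (.comp g' f')
  | pair_congr {C A B : K.Obj} {f1 f1' : Tm K D C A} {f2 f2' : Tm K D C B} :
      Eqv K D f1 f1' → Eqv K D f2 f2' → Eqv K D (.pair f1 f2) (.pair f1' f2')
  | curry_congr {A B C : K.Obj} {f f' : Tm K D (K.prod A C) B} :
      Eqv K D f f' → Eqv K D (.curry f) (.curry f')
  | comp_id {A B : K.Obj} (f : Tm K D A B) :
      Eqv K D (.comp f (.arr (K.id A))) f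
  | id_comp {A B : K.Obj} (f : Tm K D A B) :
      Eqv K D (.comp (.arr (K.id B)) f) f
  | assoc {A B C E : K.Obj} (f : Tm K D A B) (g : Tm K D B C) (h : Tm K D C E) :
      Eqv K D (.comp h (.comp g f)) (.comp (.comp h g) f)
  | T_eta {A : K.Obj} (f : Tm K D A K.T) : Eqv K D f (.arr (K.k A))
  | prod_beta1 {C A B : K.Obj} (f1 : Tm K D C A) (f2 : Tm K D C B) :
      Eqv K D (.comp (.arr (K.p1 A B)) (.pair f1 f2)) f1
  | prod_beta2 {C A B : K.Obj} (f1 : Tm K D C A) (f2 : Tm K D C B) :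
      Eqv K D (.comp (.arr (K.p2 A B)) (.pair f1 f2)) f2
  | prod_eta {C A B : K.Obj} (h : Tm K D C (K.prod A B)) :
      Eqv K D (.pair (.comp (.arr (K.p1 A B)) h) (.comp (.arr (K.p2 A B)) h)) h
  | exp_beta {A B C : K.Obj} (f : Tm K D (K.prod A C) B) :
      Eqv K D (Tm.phiS (.curry f)) f
  | exp_eta {A B C : K.Obj} (g : Tm K D C (K.exp A B)) :
      Eqv K D (.curry (Tm.phiS g)) g
  | arr_comp {A B C : K.Obj} (f : K.Hom A B) (g : K.Hom B C) :
      Eqv K D (.comp (.arr g) (.arr f)) (.arr (K.comp g f))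
  | arr_pair {C A B : K.Obj} (f1 : K.Hom C A) (f2 : K.Hom C B) :
      Eqv K D (.pair (.arr f1) (.arr f2)) (.arr (K.pair f1 f2))
  | arr_curry {A B C : K.Obj} (f : K.Hom (K.prod A C) B) :
      Eqv K D (.curry (.arr f)) (.arr (K.curry f))

instance tmSetoid (K : CC.{u, v}) (D : K.Obj) (A B : K.Obj) : Setoid (Tm K D A B) :=
  ⟨Eqv K D, ⟨Eqv.refl, Eqv.symm, Eqv.trans⟩⟩

/-- Hom-sets of the polynomial category `K[x]`: `≡`-equivalence classes of
arrow terms of `𝒮`. -/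
def KxHom (K : CC.{u, v}) (D : K.Obj) (A B : K.Obj) : Type (max u v) :=
  Quotient (tmSetoid K D A B)

/-- `[f]`, the `≡`-class of an arrow term `f`. -/
def cls {K : CC.{u, v}} {D A B : K.Obj} (f : Tm K D A B) : KxHom K D A B :=
  Quotient.mk (tmSetoid K D A B) f

/-- The polynomial cartesian closed category `K[x]`: same objects as `K`,
arrows the `≡`-classes, all structure induced classwise. -/
def Kx (K : CC.{u, v}) (D : K.Obj) : CC.{u, max u v} where
  Obj := K.Obj
  Hom := KxHom K D
  id A := cls (.arr (K.id A))
  comp g f :=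
    Quotient.map₂ Tm.comp (fun _ _ hg _ _ hf => Eqv.comp_congr hg hf) g f
  T := K.T
  prod := K.prod
  exp := K.exp
  k A := cls (.arr (K.k A))
  p1 A B := cls (.arr (K.p1 A B))
  p2 A B := cls (.arr (K.p2 A B))
  eval A B := cls (.arr (K.eval A B))
  pair f1 f2 :=
    Quotient.map₂ Tm.pair (fun _ _ h1 _ _ h2 => Eqv.pair_congr h1 h2) f1 f2
  curry f := Quotient.map Tm.curry (fun _ _ h => Eqv.curry_congr h) f
  comp_id f := Quotient.inductionOn f fun t => Quotient.sound (Eqv.comp_id t)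
  id_comp f := Quotient.inductionOn f fun t => Quotient.sound (Eqv.id_comp t)
  assoc f g h :=
    Quotient.inductionOn₃ f g h fun f g h => Quotient.sound (Eqv.assoc f g h)
  T_eta f := Quotient.inductionOn f fun t => Quotient.sound (Eqv.T_eta t)
  prod_beta1 f1 f2 :=
    Quotient.inductionOn₂ f1 f2 fun t1 t2 => Quotient.sound (Eqv.prod_beta1 t1 t2)
  prod_beta2 f1 f2 :=
    Quotient.inductionOn₂ f1 f2 fun t1 t2 => Quotient.sound (Eqv.prod_beta2 t1 t2)
  prod_eta h := Quotient.inductionOn h fun t => Quotient.sound (Eqv.prod_eta t)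
  exp_beta f := Quotient.inductionOn f fun t => Quotient.sound (Eqv.exp_beta t)
  exp_eta g := Quotient.inductionOn g fun t => Quotient.sound (Eqv.exp_eta t)

/-- The heritage map: identity on objects, `H f = [f]` on arrows. -/
def Hmap (K : CC.{u, v}) (D : K.Obj) {A B : K.Obj} (f : K.Hom A B) : KxHom K D A B :=
  cls (.arr f)

namespace Tm

/-- `Φ′ₓ`, defined by recursion on arrow terms `f : A ⊢ B` of `𝒮`,
with `Φ′ₓ f : D×A ⊢ B` an arrow of `K`. -/
def phiP {K : CC.{u, v}} {D : K.Obj} : {A B : K.Obj} → Tm K D A B → K.Hom (K.prod D A) B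
  | _, _, .x => K.p1 D K.T
  | A, _, .arr f => K.comp f (K.p2 D A)
  | A, _, .comp g f => K.comp (phiP g) (K.pair (K.p1 D A) (phiP f))
  | _, _, .pair f1 f2 => K.pair (phiP f1) (phiP f2)
  | C, _, @Tm.curry _ _ A B _ f =>
      K.curry (K.comp (phiP f)
        (K.comp (K.bl D A C)
          (K.comp (K.prodMap (K.cswap A D) (K.id C)) (K.br A D C))))

end Tm

/-- The canonical arrow term representing `Γ′_{x,A} f = [f] ∘ ⟨[x] ∘ k_A, 1_A⟩`. -/
def gammaTm (K : CC.{u, v}) (D : K.Obj) {A B : K.Obj} (f : K.Hom (K.prod D A) B) :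
    Tm K D A B :=
  Tm.comp (.arr f) (Tm.pair (Tm.comp Tm.x (.arr (K.k A))) (.arr (K.id A)))

/-- `Γ′_{x,A} f = [f] ∘ ⟨[x] ∘ k_A, 1_A⟩ : A ⊢ B` in `K[x]`,
for `f : D×A ⊢ B` in `K`. -/
def gammaP (K : CC.{u, v}) (D : K.Obj) {A B : K.Obj} (f : K.Hom (K.prod D A) B) :
    KxHom K D A B :=
  (Kx K D).comp (cls (.arr f))
    ((Kx K D).pair ((Kx K D).comp (cls Tm.x) ((Kx K D).k A)) ((Kx K D).id A))

/-- A strict cartesian closed functor between CC categories: preserves the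
terminal object, products, exponentials, `k`, `p¹`, `p²`, `ε`, pairing and
currying on the nose (heterogeneous equality is used across the object
identifications). -/
structure CCFunctor (K L : CC) where
  obj : K.Obj → L.Obj
  map : ∀ {A B : K.Obj}, K.Hom A B → L.Hom (obj A) (obj B)
  map_id : ∀ A, map (K.id A) = L.id (obj A)
  map_comp : ∀ {A B C : K.Obj} (f : K.Hom A B) (g : K.Hom B C),
    map (K.comp g f) = L.comp (map g) (map f)
  obj_T : obj K.T = L.T
  obj_prod : ∀ A B, obj (K.prod A B) = L.prod (obj A) (obj B)
  obj_exp : ∀ A B, obj (K.exp A B) = L.exp (obj A) (obj B)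
  map_k : ∀ A, HEq (map (K.k A)) (L.k (obj A))
  map_p1 : ∀ A B, HEq (map (K.p1 A B)) (L.p1 (obj A) (obj B))
  map_p2 : ∀ A B, HEq (map (K.p2 A B)) (L.p2 (obj A) (obj B))
  map_eval : ∀ A B, HEq (map (K.eval A B)) (L.eval (obj A) (obj B))
  map_pair : ∀ {C A B : K.Obj} (f1 : K.Hom C A) (f2 : K.Hom C B),
    HEq (map (K.pair f1 f2)) (L.pair (map f1) (map f2))
  map_curry : ∀ {A B C : K.Obj} (f : K.Hom (K.prod A C) B)
    (g : L.Hom (L.prod (obj A) (obj C)) (obj B)), HEq (map f) g →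
    HEq (map (K.curry f)) (L.curry g)

universe u₂ v₂

namespace CC

variable {L : CC.{u₂, v₂}}

/-- Transport of an arrow along equalities of its source and target. -/
def castHom {A A' B B' : L.Obj} (hA : A = A') (hB : B = B') (f : L.Hom A B) :
    L.Hom A' B' :=
  hB ▸ hA ▸ f

theorem castHom_heq {A A' B B' : L.Obj} (hA : A = A') (hB : B = B') (f : L.Hom A B) :
    HEq (castHom hA hB f) f := by
  subst hA hB
  rfl

theorem comp_heq {A A' B B' C C' : L.Obj} (hA : A = A') (hB : B = B') (hC : C = C')
    {g : L.Hom B C} {g' : L.Hom B' C'} {f : L.Hom A B} {f' : L.Hom A' B'}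
    (hg : HEq g g') (hf : HEq f f') : HEq (L.comp g f) (L.comp g' f') := by
  subst hA hB hC
  cases hg
  cases hf
  rfl

theorem pair_heq {A A' B B' C C' : L.Obj} (hA : A = A') (hB : B = B') (hC : C = C')
    {f : L.Hom C A} {f' : L.Hom C' A'} {g : L.Hom C B} {g' : L.Hom C' B'}
    (hf : HEq f f') (hg : HEq g g') : HEq (L.pair f g) (L.pair f' g') := by
  subst hA hB hC
  cases hg
  cases hf
  rfl

theorem curry_heq {A A' B B' C C' : L.Obj} (hA : A = A') (hB : B = B') (hC : C = C')
    {f : L.Hom (L.prod A C) B} {f' : L.Hom (L.prod A' C') B'}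
    (hf : HEq f f') : HEq (L.curry f) (L.curry f') := by
  subst hA hB hC
  cases hf
  rfl

end CC

/-- Strict cartesian closed functors agreeing on objects and on arrows are equal. -/
theorem CCFunctor.ext_heq {K : CC.{u, v}} {L : CC.{u₂, v₂}} {N N' : CCFunctor K L}
    (hobj : ∀ A, N.obj A = N'.obj A)
    (hmap : ∀ {A B : K.Obj} (g : K.Hom A B), HEq (N.map g) (N'.map g)) : N = N' := by
  obtain ⟨obj, map, _, _, _, _, _, _, _, _, _, _, _⟩ := N
  obtain ⟨obj', map', _, _, _, _, _, _, _, _, _, _, _⟩ := N'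
  obtain rfl : obj = obj' := funext hobj
  obtain rfl : @map = @map' := by
    funext A B g
    exact eq_of_heq (hmap g)
  rfl

namespace Tm

variable {K : CC.{u, v}} {D : K.Obj} {L : CC.{u₂, v₂}}

/-- Interpretation of arrow terms in `L` which extends `M` and sends `x` to `f`. -/
def interp (M : CCFunctor K L) (f : L.Hom L.T (M.obj D)) :
    {A B : K.Obj} → Tm K D A B → L.Hom (M.obj A) (M.obj B)
  | _, _, .x => CC.castHom M.obj_T.symm rfl f
  | _, _, .arr g => M.map g
  | _, _, .comp t s => L.comp (interp M f t) (interp M f s)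
  | _, _, .pair t s =>
      CC.castHom rfl (M.obj_prod _ _).symm (L.pair (interp M f t) (interp M f s))
  | _, _, .curry t =>
      CC.castHom rfl (M.obj_exp _ _).symm
        (L.curry (CC.castHom (M.obj_prod _ _) rfl (interp M f t)))

variable (M : CCFunctor K L) (f : L.Hom L.T (M.obj D))

theorem interp_x : HEq (interp M f .x) f :=
  CC.castHom_heq _ _ _

theorem interp_pair {A B C : K.Obj} (t : Tm K D C A) (s : Tm K D C B) :
    HEq (interp M f (.pair t s)) (L.pair (interp M f t) (interp M f s)) :=
  CC.castHom_heq _ _ _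

theorem interp_curry {A B C : K.Obj} (t : Tm K D (K.prod A C) B)
    (g : L.Hom (L.prod (M.obj A) (M.obj C)) (M.obj B)) (hg : HEq (interp M f t) g) :
    HEq (interp M f (.curry t)) (L.curry g) :=
  (CC.castHom_heq _ _ _).trans
    (CC.curry_heq rfl rfl rfl ((CC.castHom_heq _ _ _).trans hg))

theorem interp_phiS {A B C : K.Obj} (t : Tm K D C (K.exp A B))
    (g : L.Hom (M.obj C) (L.exp (M.obj A) (M.obj B))) (hg : HEq (interp M f t) g) :
    HEq (interp M f (phiS t)) (L.phi g) :=
  CC.comp_heq (M.obj_prod _ _) ((M.obj_prod _ _).trans (by rw [M.obj_exp])) rfl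
    (M.map_eval A B)
    ((interp_pair M f _ _).trans
      (CC.pair_heq rfl (M.obj_exp _ _) (M.obj_prod _ _)
        (CC.comp_heq (M.obj_prod _ _) rfl rfl (heq_of_eq (M.map_id A)) (M.map_p1 A C))
        (CC.comp_heq (M.obj_prod _ _) rfl (M.obj_exp _ _) hg (M.map_p2 A C))))

/-- Equivalent arrow terms have equal interpretations. -/
theorem interp_eq_of_eqv {A B : K.Obj} {t s : Tm K D A B} (h : Eqv K D t s) :
    interp M f t = interp M f s := by
  induction h with
  | refl => rfl
  | symm _ ih => exact ih.symm
  | trans _ _ ih₁ ih₂ => exact ih₁.trans ih₂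
  | comp_congr _ _ ih₁ ih₂ => simp only [interp, ih₁, ih₂]
  | pair_congr _ _ ih₁ ih₂ => simp only [interp, ih₁, ih₂]
  | curry_congr _ ih => simp only [interp, ih]
  | comp_id t => simp only [interp, M.map_id, L.comp_id]
  | id_comp t => simp only [interp, M.map_id, L.id_comp]
  | assoc r s t => exact L.assoc _ _ _
  | @T_eta A t =>
    have h : CC.castHom rfl M.obj_T (interp M f t) = L.k (M.obj A) := L.T_eta _
    exact eq_of_heq ((CC.castHom_heq rfl M.obj_T _).symm.trans
      ((heq_of_eq h).trans (M.map_k A).symm))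
  | @prod_beta1 C A B t s =>
    exact eq_of_heq ((CC.comp_heq rfl (M.obj_prod A B) rfl (M.map_p1 A B)
      (interp_pair M f t s)).trans (heq_of_eq (L.prod_beta1 _ _)))
  | @prod_beta2 C A B t s =>
    exact eq_of_heq ((CC.comp_heq rfl (M.obj_prod A B) rfl (M.map_p2 A B)
      (interp_pair M f t s)).trans (heq_of_eq (L.prod_beta2 _ _)))
  | @prod_eta C A B t =>
    have h := CC.castHom_heq rfl (M.obj_prod A B) (interp M f t)
    exact eq_of_heq ((interp_pair M f _ _).trans
      ((CC.pair_heq rfl rfl rfl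
        (CC.comp_heq rfl (M.obj_prod A B) rfl (M.map_p1 A B) h.symm)
        (CC.comp_heq rfl (M.obj_prod A B) rfl (M.map_p2 A B) h.symm)).trans
      ((heq_of_eq (L.prod_eta _)).trans h)))
  | @exp_beta A B C t =>
    have h := CC.castHom_heq (M.obj_prod A C) rfl (interp M f t)
    exact eq_of_heq ((interp_phiS M f _ _ (interp_curry M f t _ h.symm)).trans
      ((heq_of_eq (L.exp_beta _)).trans h))
  | @exp_eta A B C t =>
    have h := CC.castHom_heq rfl (M.obj_exp A B) (interp M f t)
    exact eq_of_heq ((interp_curry M f _ _ (interp_phiS M f t _ h.symm)).trans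
      ((heq_of_eq (L.exp_eta _)).trans h))
  | arr_comp g h => exact (M.map_comp g h).symm
  | arr_pair g h => exact eq_of_heq ((interp_pair M f _ _).trans (M.map_pair g h).symm)
  | @arr_curry A B C g =>
    have h := CC.castHom_heq (M.obj_prod A C) rfl (M.map g)
    exact eq_of_heq ((interp_curry M f (.arr g) _ h.symm).trans (M.map_curry g _ h.symm).symm)

/-- A strict cartesian closed functor on `K[x]` is determined on arrow terms by
its values on `x` and on the arrows of `K`. -/
theorem map_cls_heq_interp (N : CCFunctor (Kx K D) L)
    (hx : HEq (N.map (cls (Tm.x (K := K) (D := D)))) f)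
    (hobj : ∀ A : K.Obj, N.obj A = M.obj A)
    (harr : ∀ (A B : K.Obj) (g : K.Hom A B), HEq (N.map (cls (Tm.arr g))) (M.map g))
    {A B : K.Obj} (t : Tm K D A B) : HEq (N.map (cls t)) (interp M f t) := by
  induction t with
  | x => exact hx.trans (interp_x M f).symm
  | arr g => exact harr _ _ g
  | comp t s iht ihs =>
    exact (heq_of_eq (N.map_comp (cls s) (cls t))).trans
      (CC.comp_heq (hobj _) (hobj _) (hobj _) iht ihs)
  | pair t s iht ihs =>
    exact (N.map_pair (cls t) (cls s)).trans
      ((CC.pair_heq (hobj _) (hobj _) (hobj _) iht ihs).trans (interp_pair M f t s).symm)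
  | @curry A B C t ih =>
    have h := CC.castHom_heq (N.obj_prod A C) rfl (N.map (cls t))
    have h' := CC.castHom_heq (M.obj_prod A C) rfl (interp M f t)
    exact (N.map_curry (cls t) _ h.symm).trans
      ((CC.curry_heq (hobj _) (hobj _) (hobj _) (h.trans (ih.trans h'.symm))).trans
        (interp_curry M f t _ h'.symm).symm)

end Tm

/-- The strict cartesian closed functor `K[x] → L` extending `M` and sending `x` to `f`. -/
def Kx.lift {K : CC.{u, v}} {D : K.Obj} {L : CC.{u₂, v₂}} (M : CCFunctor K L)
    (f : L.Hom L.T (M.obj D)) : CCFunctor (Kx K D) L where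
  obj := M.obj
  map g := Quotient.lift (Tm.interp M f) (fun _ _ h => Tm.interp_eq_of_eqv M f h) g
  map_id := M.map_id
  map_comp f g := Quotient.inductionOn₂ f g fun _ _ => rfl
  obj_T := M.obj_T
  obj_prod := M.obj_prod
  obj_exp := M.obj_exp
  map_k := M.map_k
  map_p1 := M.map_p1
  map_p2 := M.map_p2
  map_eval := M.map_eval
  map_pair g h := Quotient.inductionOn₂ g h fun t s => Tm.interp_pair M f t s
  map_curry g := Quotient.inductionOn g fun t k hk => Tm.interp_curry M f t k hk

/-- the universal property of `K[x]` and the heritage functor `H`: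
for every CC category `L`, every strict CC functor `M : K → L` and every arrow
`f : T ⊢ M D` of `L`, there is a unique strict CC functor `N : K[x] → L` with
`N x = f` and `M = N ∘ H` (`H` being the identity on objects with `H g = [g]`). -/
theorem statement2 (K : CC.{u, v}) (D : K.Obj) (L : CC.{u₂, v₂})
    (M : CCFunctor K L) (f : L.Hom L.T (M.obj D)) :
    ∃! N : CCFunctor (Kx K D) L,
      HEq (N.map (cls (Tm.x (K := K) (D := D)))) f ∧
      (∀ A : K.Obj, N.obj A = M.obj A) ∧
      (∀ (A B : K.Obj) (g : K.Hom A B), HEq (N.map (cls (Tm.arr g))) (M.map g)) := by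
  refine ⟨Kx.lift M f, ⟨Tm.interp_x M f, fun _ => rfl, fun _ _ _ => HEq.rfl⟩, ?_⟩
  rintro N ⟨hx, hobj, harr⟩
  exact CCFunctor.ext_heq hobj fun g =>
    Quotient.inductionOn g fun t => Tm.map_cls_heq_interp M f N hx hobj harr t
end

section
/- (Lemma 1) Let 𝒦 be a cartesian closed category, D an object of 𝒦, 𝒮 the cartesian closed system obtained by adjoining an indeterminate x : 𝖳 ⊢ D, and Φ′ₓ the recursively defined map from arrow terms of 𝒮 of type A ⊢ B to arrows of 𝒦 of type D×A ⊢ B. If f ≡ g for arrow terms f, g of 𝒮 (equivalently, [f] = [g] in 𝒦[x]), then Φ′ₓf = Φ′ₓg in 𝒦. -/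
/-! Equational presentation of cartesian closed categories (Lambek/Došen style),
the polynomial extension `K[x]` by an indeterminate `x : T ⊢ D`, and the
functional-completeness apparatus. -/

universe u v

namespace CC

variable (K : CC.{u, v})

theorem assoc_right {A B C E : K.Obj} (f : K.Hom A B) (g : K.Hom B C) (h : K.Hom C E) :
    K.comp (K.comp h g) f = K.comp h (K.comp g f) :=
  (K.assoc f g h).symm

theorem p1_comp_pair_comp {C A B E : K.Obj} (f₁ : K.Hom C A) (f₂ : K.Hom C B) (h : K.Hom E C) :
    K.comp (K.p1 A B) (K.comp (K.pair f₁ f₂) h) = K.comp f₁ h := by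
  rw [K.assoc, K.prod_beta1]

theorem p2_comp_pair_comp {C A B E : K.Obj} (f₁ : K.Hom C A) (f₂ : K.Hom C B) (h : K.Hom E C) :
    K.comp (K.p2 A B) (K.comp (K.pair f₁ f₂) h) = K.comp f₂ h := by
  rw [K.assoc, K.prod_beta2]

theorem pair_comp {C A B E : K.Obj} (f₁ : K.Hom C A) (f₂ : K.Hom C B) (h : K.Hom E C) :
    K.comp (K.pair f₁ f₂) h = K.pair (K.comp f₁ h) (K.comp f₂ h) := by
  rw [← K.prod_eta (K.comp (K.pair f₁ f₂) h), p1_comp_pair_comp, p2_comp_pair_comp]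

theorem pair_p1_p2 (A B : K.Obj) : K.pair (K.p1 A B) (K.p2 A B) = K.id (K.prod A B) := by
  simpa only [K.comp_id] using K.prod_eta (K.id (K.prod A B))

theorem eval_comp_pair_curry {A B C E : K.Obj} (f : K.Hom (K.prod A C) B)
    (a : K.Hom E A) (h : K.Hom E C) :
    K.comp (K.eval A B) (K.pair a (K.comp (K.curry f) h)) = K.comp f (K.pair a h) := by
  conv_rhs => rw [← K.exp_beta f]
  simp only [assoc_right, pair_comp, K.prod_beta1, K.prod_beta2, K.id_comp]

theorem curry_comp {A B C E : K.Obj} (f : K.Hom (K.prod A C) B) (h : K.Hom E C) :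
    K.comp (K.curry f) h = K.curry (K.comp f (K.pair (K.p1 A E) (K.comp h (K.p2 A E)))) := by
  rw [← K.exp_eta (K.comp (K.curry f) h)]
  simp only [assoc_right, eval_comp_pair_curry, K.id_comp]

/-- The composite exchanging the two outer factors in `A × (D × C)`, in normal form. -/
theorem exchange_eq (A D C : K.Obj) :
    K.comp (K.bl D A C) (K.comp (K.prodMap (K.cswap A D) (K.id C)) (K.br A D C)) =
      K.pair (K.comp (K.p1 D C) (K.p2 A (K.prod D C)))
        (K.pair (K.p1 A (K.prod D C)) (K.comp (K.p2 D C) (K.p2 A (K.prod D C)))) := by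
  simp only [bl, br, cswap, prodMap, assoc_right, pair_comp, K.prod_beta1, K.prod_beta2, K.id_comp]

end CC

/-- Lemma 1: if `f ≡ g` for arrow terms `f, g` of `𝒮`
(equivalently, `[f] = [g]` in `K[x]`), then `Φ′ₓ f = Φ′ₓ g` in `K`. -/
theorem statement3 (K : CC.{u, v}) (D : K.Obj) {A B : K.Obj}
    (f g : Tm K D A B) (h : Eqv K D f g) : f.phiP = g.phiP := by
  induction h with
  | refl => rfl
  | symm _ ih => exact ih.symm
  | trans _ _ ih₁ ih₂ => exact ih₁.trans ih₂
  | comp_congr _ _ ih₁ ih₂ => simp only [Tm.phiP, ih₁, ih₂]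
  | pair_congr _ _ ih₁ ih₂ => simp only [Tm.phiP, ih₁, ih₂]
  | curry_congr _ ih => simp only [Tm.phiP, ih]
  | T_eta f => exact (K.T_eta _).trans (K.T_eta _).symm
  | exp_beta f =>
    simp only [Tm.phiP, Tm.phiS, K.exchange_eq, K.assoc_right, K.pair_comp, K.prod_beta1,
      K.prod_beta2, K.id_comp, K.eval_comp_pair_curry, K.prod_eta, K.pair_p1_p2, K.comp_id]
  | exp_eta g =>
    simp only [Tm.phiP, Tm.phiS, K.exchange_eq, K.assoc_right, K.pair_comp, K.prod_beta1,
      K.prod_beta2, K.id_comp, K.prod_eta]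
    simpa only [K.id_comp] using K.exp_eta g.phiP
  | arr_curry f =>
    simp only [Tm.phiP, K.exchange_eq, K.assoc_right, K.prod_beta2, K.curry_comp]
  | _ =>
    simp only [Tm.phiP, K.assoc_right, K.pair_comp, K.prod_beta1, K.prod_beta2, K.prod_eta,
      K.id_comp, K.pair_p1_p2, K.comp_id]
end

section
/- (Lemma 2) Let 𝒦 be a cartesian closed category, D an object of 𝒦, 𝒦[x] the polynomial cartesian closed category obtained by adjoining an indeterminate x : 𝖳 ⊢ D, Φ′ₓ the map induced on classes by the recursively defined assignment of arrows Φ′ₓf : D×A ⊢ B of 𝒦 to arrow terms f : A ⊢ B, and Γ′_{x,A}f = [f] ∘ ⟨[x]∘k_A, 𝟏_A⟩ for f : D×A ⊢ B in 𝒦. Then for every arrow [f] : A ⊢ B of 𝒦[x] we have Γ′_{x,A}Φ′ₓ[f] = [f] in 𝒦[x]. -/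
/-! Equational presentation of cartesian closed categories (Lambek/Došen style),
the polynomial extension `K[x]` by an indeterminate `x : T ⊢ D`, and the
functional-completeness apparatus. -/

universe u v

namespace CC

variable (L : CC)

theorem pair_ext {A B C : L.Obj} {f g : L.Hom C (L.prod A B)}
    (h₁ : L.comp (L.p1 A B) f = L.comp (L.p1 A B) g)
    (h₂ : L.comp (L.p2 A B) f = L.comp (L.p2 A B) g) : f = g := by
  rw [← L.prod_eta f, ← L.prod_eta g, h₁, h₂]

theorem comp_assoc {A B C E : L.Obj} (f : L.Hom A B) (g : L.Hom B C) (h : L.Hom C E) :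
    L.comp (L.comp h g) f = L.comp h (L.comp g f) :=
  (L.assoc f g h).symm

theorem p1_pair_assoc {A B C E : L.Obj} (f : L.Hom C A) (g : L.Hom C B) (h : L.Hom E C) :
    L.comp (L.p1 A B) (L.comp (L.pair f g) h) = L.comp f h := by
  rw [L.assoc, L.prod_beta1]

theorem p2_pair_assoc {A B C E : L.Obj} (f : L.Hom C A) (g : L.Hom C B) (h : L.Hom E C) :
    L.comp (L.p2 A B) (L.comp (L.pair f g) h) = L.comp g h := by
  rw [L.assoc, L.prod_beta2]

theorem pair_comp_s4 {A B C E : L.Obj} (f : L.Hom C A) (g : L.Hom C B) (h : L.Hom E C) :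
    L.comp (L.pair f g) h = L.pair (L.comp f h) (L.comp g h) := by
  apply L.pair_ext <;>
    simp only [p1_pair_assoc, p2_pair_assoc, prod_beta1, prod_beta2]

theorem pair_p1_p2_s4 (A B : L.Obj) : L.pair (L.p1 A B) (L.p2 A B) = L.id (L.prod A B) := by
  simpa only [comp_id] using L.prod_eta (L.id (L.prod A B))

theorem eval_pair_curry {A B C E : L.Obj} (f : L.Hom (L.prod A C) B)
    (a : L.Hom E A) (c : L.Hom E C) :
    L.comp (L.eval A B) (L.pair a (L.comp (L.curry f) c)) = L.comp f (L.pair a c) := by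
  conv_rhs => rw [← L.exp_beta f]
  simp only [comp_assoc, pair_comp_s4, id_comp, prod_beta1, prod_beta2]

theorem eval_pair_curry_id {A B C : L.Obj} (f : L.Hom (L.prod A C) B) (a : L.Hom C A) :
    L.comp (L.eval A B) (L.pair a (L.curry f)) = L.comp f (L.pair a (L.id C)) := by
  rw [← L.eval_pair_curry f, comp_id]

theorem curry_comp_s4 {A B C E : L.Obj} (f : L.Hom (L.prod A C) B) (h : L.Hom E C) :
    L.comp (L.curry f) h =
      L.curry (L.comp f (L.pair (L.p1 A E) (L.comp h (L.p2 A E)))) := by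
  rw [← L.exp_eta (L.comp (L.curry f) h)]
  simp only [comp_assoc, id_comp, eval_pair_curry]

theorem k_comp {A B : L.Obj} (f : L.Hom A B) : L.comp (L.k B) f = L.k A :=
  L.T_eta _

/-- The exchange arrow `A×(D×C) ⊢ D×(A×C)` in components. -/
theorem exchange_eq_s4 (A D C : L.Obj) :
    L.comp (L.bl D A C) (L.comp (L.prodMap (L.cswap A D) (L.id C)) (L.br A D C)) =
      L.pair (L.comp (L.p1 D C) (L.p2 A (L.prod D C)))
        (L.pair (L.p1 A (L.prod D C)) (L.comp (L.p2 D C) (L.p2 A (L.prod D C)))) := by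
  simp only [bl, br, cswap, prodMap, comp_assoc, pair_comp_s4, id_comp, prod_beta1, prod_beta2]

/-- Substituting a global element commutes with composition. -/
theorem subst_comp {A B C D : L.Obj} (x : L.Hom L.T D) (g : L.Hom (L.prod D B) C)
    (f : L.Hom (L.prod D A) B) :
    L.comp (L.comp g (L.pair (L.p1 D A) f)) (L.pair (L.comp x (L.k A)) (L.id A)) =
      L.comp (L.comp g (L.pair (L.comp x (L.k B)) (L.id B)))
        (L.comp f (L.pair (L.comp x (L.k A)) (L.id A))) := by
  simp only [comp_assoc, pair_comp_s4, id_comp, prod_beta1, k_comp]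

/-- Substituting a global element commutes with currying. -/
theorem subst_curry {A B C D : L.Obj} (x : L.Hom L.T D)
    (f : L.Hom (L.prod D (L.prod A C)) B) :
    L.comp
        (L.curry (L.comp f (L.pair (L.comp (L.p1 D C) (L.p2 A (L.prod D C)))
          (L.pair (L.p1 A (L.prod D C)) (L.comp (L.p2 D C) (L.p2 A (L.prod D C)))))))
        (L.pair (L.comp x (L.k C)) (L.id C)) =
      L.curry (L.comp f (L.pair (L.comp x (L.k (L.prod A C))) (L.id (L.prod A C)))) := by
  simp only [curry_comp_s4, comp_assoc, pair_comp_s4, id_comp, prod_beta1, prod_beta2, k_comp,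
    pair_p1_p2_s4]

end CC

open CC in
/-- `Φ′ₓ` respects `≡`. -/
theorem Tm.phiP_eq_of_eqv {K : CC.{u, v}} {D A B : K.Obj} {s t : Tm K D A B}
    (h : Eqv K D s t) : s.phiP = t.phiP := by
  induction h with
  | refl => rfl
  | symm _ ih => exact ih.symm
  | trans _ _ ih₁ ih₂ => exact ih₁.trans ih₂
  | comp_congr _ _ ih₁ ih₂ => simp only [Tm.phiP, ih₁, ih₂]
  | pair_congr _ _ ih₁ ih₂ => simp only [Tm.phiP, ih₁, ih₂]
  | curry_congr _ ih => simp only [Tm.phiP, ih]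
  | T_eta f => rw [K.T_eta f.phiP, K.T_eta (Tm.phiP _)]
  | prod_eta h =>
    simp only [Tm.phiP, comp_assoc, prod_beta2, prod_eta]
  | exp_eta g =>
    simp only [Tm.phiP, Tm.phiS, exchange_eq_s4, comp_assoc, pair_comp_s4, id_comp, prod_beta1,
      prod_beta2]
    conv_rhs => rw [← K.exp_eta g.phiP, id_comp]
    rw [prod_eta]
  | exp_beta f =>
    simp only [Tm.phiP, Tm.phiS, exchange_eq_s4, comp_assoc, pair_comp_s4, id_comp, prod_beta1,
      prod_beta2, curry_comp_s4]
    rw [eval_pair_curry_id]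
    simp only [comp_assoc, pair_comp_s4, comp_id, prod_beta1, prod_beta2, prod_eta, pair_p1_p2_s4]
  | _ =>
    simp only [Tm.phiP, exchange_eq_s4, comp_assoc, pair_comp_s4, id_comp, comp_id, prod_beta1,
      prod_beta2, pair_p1_p2_s4, curry_comp_s4]

theorem cls_arr_comp {K : CC.{u, v}} {D A B C : K.Obj} (g : K.Hom B C) (f : K.Hom A B) :
    (cls (.arr (K.comp g f)) : KxHom K D A C) =
      (Kx K D).comp (cls (.arr g)) (cls (.arr f)) :=
  Quotient.sound (Eqv.arr_comp f g).symm

theorem cls_arr_pair {K : CC.{u, v}} {D A B C : K.Obj} (f : K.Hom C A) (g : K.Hom C B) :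
    (cls (.arr (K.pair f g)) : KxHom K D C (K.prod A B)) =
      (Kx K D).pair (cls (.arr f)) (cls (.arr g)) :=
  Quotient.sound (Eqv.arr_pair f g).symm

theorem cls_arr_curry {K : CC.{u, v}} {D A B C : K.Obj} (f : K.Hom (K.prod A C) B) :
    (cls (.arr (K.curry f)) : KxHom K D C (K.exp A B)) = (Kx K D).curry (cls (.arr f)) :=
  Quotient.sound (Eqv.arr_curry f).symm

theorem cls_arr_exchange {K : CC.{u, v}} {D : K.Obj} (A C : K.Obj) :
    (cls (.arr (K.pair (K.comp (K.p1 D C) (K.p2 A (K.prod D C)))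
        (K.pair (K.p1 A (K.prod D C)) (K.comp (K.p2 D C) (K.p2 A (K.prod D C)))))) :
        KxHom K D (K.prod A (K.prod D C)) (K.prod D (K.prod A C))) =
      (Kx K D).pair ((Kx K D).comp ((Kx K D).p1 D C) ((Kx K D).p2 A (K.prod D C)))
        ((Kx K D).pair ((Kx K D).p1 A (K.prod D C))
          ((Kx K D).comp ((Kx K D).p2 D C) ((Kx K D).p2 A (K.prod D C)))) :=
  (cls_arr_pair _ _).trans (congrArg₂ (Kx K D).pair (cls_arr_comp _ _)
    ((cls_arr_pair _ _).trans (congrArg ((Kx K D).pair _) (cls_arr_comp _ _))))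

/-- `Γ′ₓ` undoes `Φ′ₓ` on arrow terms. -/
theorem gammaP_phiP {K : CC.{u, v}} {D A B : K.Obj} (t : Tm K D A B) :
    gammaP K D t.phiP = cls t := by
  induction t with
  | x =>
    refine ((Kx K D).prod_beta1 _ _).trans ?_
    exact (congrArg ((Kx K D).comp (cls Tm.x)) ((Kx K D).T_eta ((Kx K D).id K.T)).symm).trans
      ((Kx K D).comp_id _)
  | arr f =>
    unfold gammaP
    rw [Tm.phiP, cls_arr_comp]
    refine ((Kx K D).comp_assoc _ _ _).trans ?_
    refine (congrArg ((Kx K D).comp (cls (.arr f))) ((Kx K D).prod_beta2 _ _)).trans ?_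
    exact (Kx K D).comp_id _
  | comp g f ihg ihf =>
    unfold gammaP at *
    rw [Tm.phiP, cls_arr_comp, cls_arr_pair]
    refine ((Kx K D).subst_comp (cls .x) _ _).trans ?_
    exact congrArg₂ (Kx K D).comp ihg ihf
  | pair f g ihf ihg =>
    unfold gammaP at *
    rw [Tm.phiP, cls_arr_pair]
    refine ((Kx K D).pair_comp_s4 _ _ _).trans ?_
    exact congrArg₂ (Kx K D).pair ihf ihg
  | curry f ih =>
    unfold gammaP at *
    rw [Tm.phiP, K.exchange_eq_s4, cls_arr_curry]
    refine (congrArg (fun q => (Kx K D).comp ((Kx K D).curry q) _)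
      ((cls_arr_comp _ _).trans
        (congrArg ((Kx K D).comp (cls (.arr f.phiP))) (cls_arr_exchange _ _)))).trans ?_
    refine ((Kx K D).subst_curry (cls .x) _).trans ?_
    exact congrArg (Kx K D).curry ih

/-- Lemma 2: for every arrow `[f] : A ⊢ B` of `K[x]`,
`Γ′_{x,A} (Φ′ₓ [f]) = [f]` in `K[x]` (where `Φ′ₓ` is the map induced on
classes by `Φ′ₓ` on arrow terms). -/
theorem statement4 (K : CC.{u, v}) (D : K.Obj) :
    ∃ PhiQ : ∀ (A B : K.Obj), KxHom K D A B → K.Hom (K.prod D A) B,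
      (∀ (A B : K.Obj) (t : Tm K D A B), PhiQ A B (cls t) = t.phiP) ∧
      (∀ (A B : K.Obj) (h : KxHom K D A B), gammaP K D (PhiQ A B h) = h) := by
  refine ⟨fun A B => Quotient.lift Tm.phiP fun _ _ h => Tm.phiP_eq_of_eqv h, fun _ _ _ => rfl, ?_⟩
  intro A B h
  induction h using Quotient.inductionOn with
  | h t => exact gammaP_phiP t
end
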